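/- Let L be a pseudolattice in ℝ. Then the ring End(L) := {α ∈ ℝ : αL ⊆ L} is isomorphic either to ℤ or to an order in a real quadratic field. -/

import Mathlib

/-- A pseudolattice: a dense additive subgroup of `ℝ` of rank two. -/
def IsPseudolattice (L : AddSubgroup ℝ) : Prop :=
  Dense (L : Set ℝ) ∧ ∃ ω₁ ω₂ : ℝ, LinearIndependent ℚ ![ω₁, ω₂] ∧
    (L : Set ℝ) = {x : ℝ | ∃ m n : ℤ, x = m * ω₁ + n * ω₂}

/-- The multiplier ring `End(L) = {α ∈ ℝ : αL ⊆ L}` of an additive subgroup of `ℝ`. -/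
def multiplierRing (L : AddSubgroup ℝ) : Subring ℝ where
  carrier := {α : ℝ | ∀ x ∈ L, α * x ∈ L}
  one_mem' := by intro x hx; simpa using hx
  mul_mem' := by intro a b ha hb x hx; rw [mul_assoc]; exact ha _ (hb x hx)
  add_mem' := by intro a b ha hb x hx; rw [add_mul]; exact L.add_mem (ha x hx) (hb x hx)
  zero_mem' := by intro x hx; simpa using L.zero_mem
  neg_mem' := by intro a ha x hx; rw [neg_mul]; exact L.neg_mem (ha x hx)

/-- If `β` is a root of a monic rational quadratic, then `ℚ(β)` is spanned by `1` and `β`. -/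
theorem adjoin_eq_span_pair_of_sq {β : ℝ} {r s : ℚ} (h : β ^ 2 = r + s * β) :
    Subalgebra.toSubmodule (IntermediateField.adjoin ℚ {β}).toSubalgebra =
      Submodule.span ℚ (Set.range ![1, β]) := by
  have hint : IsAlgebraic ℚ β := by
    refine IsIntegral.isAlgebraic ⟨.X ^ 2 - .C s * .X - .C r, by monicity!, ?_⟩
    simp [h]
  rw [IntermediateField.adjoin_simple_toSubalgebra_of_isAlgebraic hint]
  apply le_antisymm
  · intro x hx
    replace hx : x ∈ Algebra.adjoin ℚ {β} := hx
    simp only [Matrix.range_cons, Matrix.range_empty, Set.union_empty, Set.singleton_union,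
      Submodule.mem_span_pair, Rat.smul_def]
    induction hx using Algebra.adjoin_induction with
    | mem y hy => exact ⟨0, 1, by simp [Set.mem_singleton_iff.mp hy]⟩
    | algebraMap q => exact ⟨q, 0, by simp⟩
    | add y z _ _ hy hz =>
      obtain ⟨a, b, rfl⟩ := hy
      obtain ⟨c, d, rfl⟩ := hz
      exact ⟨a + c, b + d, by push_cast; ring⟩
    | mul y z _ _ hy hz =>
      obtain ⟨a, b, rfl⟩ := hy
      obtain ⟨c, d, rfl⟩ := hz
      exact ⟨a * c + b * d * r, a * d + b * c + b * d * s, by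
        push_cast; linear_combination (-(b : ℝ) * d) * h⟩
  · rw [Submodule.span_le]
    rintro _ ⟨i, rfl⟩
    fin_cases i
    · exact one_mem (Algebra.adjoin ℚ {β})
    · exact Algebra.self_mem_adjoin_singleton ℚ β

/-- Given a `ℤ`-basis `ω₁, ω₂` of `L`, the multiplier ring is `ℤ + ℤβ` with `β` an integer
multiple of `ω₂ / ω₁`. -/
theorem exists_multiplierRing_eq {L : AddSubgroup ℝ} {ω₁ ω₂ : ℝ} (h₁ : ω₁ ≠ 0)
    (hL : (L : Set ℝ) = {x : ℝ | ∃ m n : ℤ, x = m * ω₁ + n * ω₂}) :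
    ∃ g : ℤ, (multiplierRing L : Set ℝ) =
      {x : ℝ | ∃ m n : ℤ, x = m * 1 + n * (g * (ω₂ / ω₁))} := by
  let B : AddSubgroup ℤ := (multiplierRing L).toAddSubgroup.comap
    ((AddMonoidHom.mulRight (ω₂ / ω₁)).comp (Int.castAddHom ℝ))
  have hB (b : ℤ) : b ∈ B ↔ (b : ℝ) * (ω₂ / ω₁) ∈ multiplierRing L := Iff.rfl
  obtain ⟨g, hg⟩ := Int.subgroup_cyclic B
  rw [← AddSubgroup.zmultiples_eq_closure] at hg
  refine ⟨g, Set.ext fun x => ⟨fun hx => ?_, ?_⟩⟩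
  · have hω : ω₁ ∈ (L : Set ℝ) := by
      rw [hL]
      exact ⟨1, 0, by simp⟩
    have hxω : x * ω₁ ∈ (L : Set ℝ) := hx ω₁ hω
    rw [hL] at hxω
    obtain ⟨a, b, hab⟩ := hxω
    have hxab : x = a + b * (ω₂ / ω₁) := by
      field_simp
      exact hab
    have hb : b ∈ B := by
      rw [hB, show (b : ℝ) * (ω₂ / ω₁) = x - a by rw [hxab]; ring]
      exact sub_mem hx (intCast_mem _ a)
    rw [hg, AddSubgroup.mem_zmultiples_iff] at hb
    obtain ⟨n, rfl⟩ := hb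
    exact ⟨a, n, by rw [hxab]; push_cast [smul_eq_mul]; ring⟩
  · rintro ⟨m, n, rfl⟩
    have hgB : (g : ℝ) * (ω₂ / ω₁) ∈ multiplierRing L := by
      rw [← hB, hg]
      exact AddSubgroup.mem_zmultiples g
    exact add_mem (mul_mem (intCast_mem _ m) (one_mem _)) (mul_mem (intCast_mem _ n) hgB)

/-- the ring `End(L) = {α ∈ ℝ : αL ⊆ L}` of a pseudolattice is
either `ℤ` or an order in a real quadratic field (a subring of the integers of a
degree-two subfield `K ⊆ ℝ`, free of rank two over `ℤ` and spanning `K` over `ℚ`). -/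
theorem endomorphism_ring_int_or_order (L : AddSubgroup ℝ) (hL : IsPseudolattice L) :
    multiplierRing L = (Int.castRingHom ℝ).range ∨
    ∃ K : IntermediateField ℚ ℝ, Module.finrank ℚ K = 2 ∧
      (multiplierRing L : Set ℝ) ⊆ (K : Set ℝ) ∧
      (∀ x ∈ multiplierRing L, IsIntegral ℤ x) ∧
      (K : Set ℝ) ⊆ (Submodule.span ℚ (multiplierRing L : Set ℝ) : Set ℝ) ∧
      ∃ β₁ β₂ : ℝ, LinearIndependent ℚ ![β₁, β₂] ∧
        (multiplierRing L : Set ℝ) = {x : ℝ | ∃ m n : ℤ, x = m * β₁ + n * β₂} := by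
  obtain ⟨-, ω₁, ω₂, hω, hL⟩ := hL
  have h₁ : ω₁ ≠ 0 := hω.ne_zero 0
  obtain ⟨g, hR⟩ := exists_multiplierRing_eq h₁ hL
  have hmem (x : ℝ) : x ∈ multiplierRing L ↔
      ∃ m n : ℤ, x = m * 1 + n * (g * (ω₂ / ω₁)) := Set.ext_iff.mp hR x
  rcases eq_or_ne g 0 with rfl | hg
  · left
    ext x
    rw [hmem]
    simp [eq_comm]
  right
  set β : ℝ := g * (ω₂ / ω₁) with hβ
  have hβmem : β ∈ multiplierRing L := (hmem β).mpr ⟨0, 1, by simp⟩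
  obtain ⟨r, s, hrs⟩ := (hmem (β ^ 2)).mp (pow_mem hβmem 2)
  have hind : LinearIndependent ℚ ![1, β] := by
    rw [LinearIndependent.pair_iff] at hω ⊢
    intro p q hpq
    simp only [Rat.smul_def] at hω hpq
    have hgq : (g : ℚ) ≠ 0 := by exact_mod_cast hg
    obtain ⟨hp, hq⟩ := hω p (q * g) (by
      have := congrArg (· * ω₁) hpq
      simp only [hβ, zero_mul] at this
      field_simp at this
      push_cast
      linear_combination this)
    exact ⟨hp, (mul_eq_zero.mp hq).resolve_right hgq⟩
  have hK := adjoin_eq_span_pair_of_sq (β := β) (r := r) (s := s) (by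
    push_cast
    linear_combination hrs)
  have hβint : IsIntegral ℤ β := by
    refine ⟨.X ^ 2 - .C s * .X - .C r, by monicity!, ?_⟩
    simp only [Polynomial.eval₂_sub, Polynomial.eval₂_mul, Polynomial.eval₂_X_pow,
      Polynomial.eval₂_C, Polynomial.eval₂_X]
    simp [hrs]
  refine ⟨IntermediateField.adjoin ℚ {β}, ?_, ?_, ?_, ?_, 1, β, hind, hR⟩
  · have := finrank_span_eq_card hind
    rw [← hK] at this
    simpa using this
  · intro x hx
    obtain ⟨m, n, rfl⟩ := (hmem x).mp hx
    exact add_mem (mul_mem (intCast_mem _ m) (one_mem _))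
      (mul_mem (intCast_mem _ n) (IntermediateField.mem_adjoin_simple_self ℚ β))
  · intro x hx
    obtain ⟨m, n, rfl⟩ := (hmem x).mp hx
    exact (isIntegral_algebraMap (x := m).mul isIntegral_one).add
      (isIntegral_algebraMap (x := n).mul hβint)
  · intro x hx
    have hx' : x ∈ Submodule.span ℚ (Set.range ![1, β]) := hK ▸ hx
    refine Submodule.span_mono ?_ hx'
    rintro _ ⟨i, rfl⟩
    fin_cases i
    · exact one_mem (multiplierRing L)
    · exact hβmem
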